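/- Let $F$ be an algebraically closed field of characteristic $p > 0$ and $G = Z_{p^r}$ a cyclic group of order $p^r$. If $V$ is a faithful finite-dimensional $G$-module over $F$, then $\delta(G, V) = p^r$, where $\delta(G,V)$ is the degree of reductivity: the supremum over nonzero fixed points $v \in V^G \setminus \{0\}$ of the minimal positive degree of a homogeneous invariant not vanishing at $v$. -/

import Mathlib

open MvPolynomial

/-- Action of the generator `σ` of `Z_{p^r}` on the polynomial ring of `V = ⊕_j V_{n j}`. -/
noncomputable def sigmaAct {F : Type*} [Field F] {k : ℕ} (n : Fin k → ℕ) :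
    MvPolynomial (Σ j : Fin k, Fin (n j)) F →ₐ[F] MvPolynomial (Σ j : Fin k, Fin (n j)) F :=
  aeval fun q => X q + if _ : 0 < (q.2 : ℕ) then
    X ⟨q.1, ⟨(q.2 : ℕ) - 1, lt_of_le_of_lt (Nat.sub_le _ _) q.2.isLt⟩⟩ else 0

/-- Corresponding action of the generator on points of `V`. -/
def sigmaPt {F : Type*} [Field F] {k : ℕ} (n : Fin k → ℕ)
    (v : (Σ j : Fin k, Fin (n j)) → F) : (Σ j : Fin k, Fin (n j)) → F :=
  fun q => v q + if _ : 0 < (q.2 : ℕ) then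
    v ⟨q.1, ⟨(q.2 : ℕ) - 1, lt_of_le_of_lt (Nat.sub_le _ _) q.2.isLt⟩⟩ else 0

/-- `ε(G,v)`: minimal positive degree of a homogeneous invariant not vanishing at `v`. -/
noncomputable def epsCyc {F : Type*} [Field F] {k : ℕ} (n : Fin k → ℕ)
    (v : (Σ j : Fin k, Fin (n j)) → F) : ℕ :=
  sInf {d : ℕ | 0 < d ∧ ∃ f : MvPolynomial (Σ j : Fin k, Fin (n j)) F,
    sigmaAct n f = f ∧ f.IsHomogeneous d ∧ eval v f ≠ 0}

/-- `δ(G,V)`: supremum of `ε(G,v)` over nonzero fixed points `v` (`0` if there are none). -/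
noncomputable def deltaCyc {F : Type*} [Field F] {k : ℕ} (n : Fin k → ℕ) : ℕ :=
  sSup {e : ℕ | ∃ v : (Σ j : Fin k, Fin (n j)) → F,
    v ≠ 0 ∧ sigmaPt n v = v ∧ e = epsCyc n v}

namespace Stmt4

/-- The `p^t`-th iterate of an algebra map in characteristic `p`. -/
lemma iterate_eq {F R : Type*} [Field F] [CommRing R] [Nontrivial R] [Algebra F R] {p : ℕ}
    [Fact p.Prime] [CharP F p] (σ : R →ₐ[F] R) (t : ℕ) (x : R) :
    σ^[p ^ t] x = x + (fun y => σ y - y)^[p ^ t] x := by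
  have : CharP (Module.End F R) p := charP_of_injective_algebraMap
    (algebraMap F (Module.End F R)).injective p
  have h := sub_pow_char_pow_of_commute (p := p) (n := t) (Commute.one_right (σ.toLinearMap : Module.End F R))
  have h2 := congrArg (fun g : Module.End F R => g x) h
  simp only [one_pow, LinearMap.sub_apply, Module.End.pow_apply, Module.End.one_apply] at h2
  have h3 : (⇑((σ.toLinearMap : Module.End F R) - 1)) = fun y => σ y - y := by
    funext y; simp
  rw [h3] at h2
  rw [h2]
  simp

/-- Key lemma: a polynomial invariant under `Z ↦ Z + b` is a polynomial in `Z^p` modulo `b`. -/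
lemma periodic {A B : Type*} [CommRing A] [IsDomain A] [CommRing B] {p : ℕ} [Fact p.Prime]
    [CharP A p] (π : A →+* B) (b : A) (hb : b ≠ 0) (hπ : π b = 0) :
    ∀ (N : ℕ) (g : Polynomial A), g.natDegree ≤ N → g.comp (Polynomial.X + Polynomial.C b) = g →
      ∃ h : Polynomial B, g.map π = Polynomial.expand B p h := by
  classical
  let c : ZMod p → A := fun i => ZMod.castHom dvd_rfl A i * b
  have hc : Function.Injective c := by
    intro i j hij
    have := mul_right_cancel₀ hb hij
    exact (ZMod.castHom dvd_rfl A).injective this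
  let M : Polynomial A := ∏ i : ZMod p, (Polynomial.X - Polynomial.C (c i))
  have hMmonic : M.Monic := Polynomial.monic_prod_X_sub_C _ _
  have hMdeg : M.natDegree = p := by
    simp [M, Polynomial.natDegree_prod_of_monic _ _ (fun i _ => Polynomial.monic_X_sub_C (c i)), ZMod.card]
  have hMinv : M.comp (Polynomial.X + Polynomial.C b) = M := by
    simp only [M, Polynomial.prod_comp]
    rw [← Equiv.prod_comp (Equiv.addRight (1 : ZMod p))]
    refine Finset.prod_congr rfl fun i _ => ?_
    simp [c, add_mul]
  have hMmap : M.map π = Polynomial.X ^ p := by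
    simp [M, Polynomial.map_prod, c, hπ, ZMod.card]
  intro N
  induction N using Nat.strong_induction_on with
  | _ N ih =>
  intro g hg hinv
  have hev : ∀ n : ℕ, g.eval ((n : A) * b) = g.eval 0 := by
    intro n
    induction n with
    | zero => simp
    | succ n ihn =>
      rw [← ihn]
      conv_rhs => rw [← hinv]
      simp [add_mul]
  have hev' : ∀ i, g.eval (c i) = g.eval 0 := by
    intro i
    have : c i = ((i.val : ℕ) : A) * b := by
      simp only [c]
      congr 1
      have h5 := congrArg (ZMod.castHom dvd_rfl A) (ZMod.natCast_zmod_val i)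
      rw [map_natCast] at h5
      exact h5.symm
    rw [this, hev]
  by_cases hg0 : g - Polynomial.C (g.eval 0) = 0
  · refine ⟨Polynomial.C (π (g.eval 0)), ?_⟩
    rw [sub_eq_zero] at hg0
    have := congrArg (Polynomial.map π) hg0
    rw [this, Polynomial.map_C, Polynomial.expand_C]
  have hdvd : M ∣ g - Polynomial.C (g.eval 0) := by
    have h1 := (Multiset.prod_X_sub_C_dvd_iff_le_roots hg0 (Finset.univ.val.map c)).2 ?_
    · rw [Multiset.map_map] at h1
      exact h1
    · rw [Multiset.le_iff_subset (Multiset.Nodup.map hc Finset.univ.nodup)]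
      intro a ha
      obtain ⟨i, -, rfl⟩ := Multiset.mem_map.1 ha
      rw [Polynomial.mem_roots hg0]
      simp [hev']
  obtain ⟨q, hq⟩ := hdvd
  have hq0 : q ≠ 0 := by rintro rfl; simp [hq] at hg0
  have hqinv : q.comp (Polynomial.X + Polynomial.C b) = q := by
    apply mul_left_cancel₀ hMmonic.ne_zero
    rw [← hq]
    nth_rewrite 1 [← hMinv]
    rw [← Polynomial.mul_comp, ← hq, Polynomial.sub_comp, hinv, Polynomial.C_comp]
  have hdeg : p + q.natDegree ≤ N := by
    have h2 : (M * q).natDegree = p + q.natDegree := by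
      rw [hMmonic.natDegree_mul' hq0, hMdeg]
    rw [← h2, ← hq]
    simpa using hg
  have hp : 0 < p := (Fact.out : p.Prime).pos
  obtain ⟨h, hh⟩ := ih q.natDegree (by omega) q le_rfl hqinv
  refine ⟨Polynomial.X * h + Polynomial.C (π (g.eval 0)), ?_⟩
  have : g = M * q + Polynomial.C (g.eval 0) := by rw [← hq]; ring
  conv_lhs => rw [this]
  simp [hMmap, hh]

variable (F : Type*) [Field F]

/-- truncated variables -/
noncomputable def Y (m i : ℕ) : MvPolynomial ℕ F := if i < m then X i else 0

/-- action on the small variables -/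
noncomputable def sg (m : ℕ) : MvPolynomial ℕ F →ₐ[F] MvPolynomial ℕ F :=
  aeval fun i => X i + Y F m (i + 1)

/-- truncation -/
noncomputable def tr (m : ℕ) : MvPolynomial ℕ F →ₐ[F] MvPolynomial ℕ F :=
  aeval fun i => Y F m i

/-- action on the polynomial ring in `Z` over the small variables -/
noncomputable def Sg (m a : ℕ) :
    Polynomial (MvPolynomial ℕ F) →ₐ[F] Polynomial (MvPolynomial ℕ F) :=
  { Polynomial.eval₂RingHom (Polynomial.C.comp (sg F m).toRingHom)
      (Polynomial.X + Polynomial.C (X 0 ^ a)) with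
    commutes' := by
      intro c
      simp [Polynomial.algebraMap_apply] }

lemma Sg_X (m a : ℕ) : Sg F m a Polynomial.X = Polynomial.X + Polynomial.C (X 0 ^ a) := by
  change Polynomial.eval₂ _ _ _ = _
  simp

lemma Sg_C (m a : ℕ) (x) : Sg F m a (Polynomial.C x) = Polynomial.C (sg F m x) := by
  change Polynomial.eval₂ _ _ _ = _
  simp

lemma sg_Y (m i : ℕ) : sg F m (Y F m i) = Y F m i + Y F m (i + 1) := by
  by_cases h : i < m
  · simp [Y, sg, h]
  · have : ¬ i + 1 < m := by omega
    simp [Y, h, this]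

/-- Two ring homs out of `F[y][Z]` agreeing on generators agree. -/
lemma hom_ext {S : Type*} [CommRing S] (f g : Polynomial (MvPolynomial ℕ F) →+* S)
    (h0 : ∀ c : F, f (Polynomial.C (C c)) = g (Polynomial.C (C c)))
    (h1 : ∀ i, f (Polynomial.C (X i)) = g (Polynomial.C (X i)))
    (h2 : f Polynomial.X = g Polynomial.X) : f = g := by
  apply Polynomial.ringHom_ext' _ h2
  apply MvPolynomial.ringHom_ext
  · intro c; simpa using h0 c
  · intro i; simpa using h1 i

lemma iterate_Y {p : ℕ} [Fact p.Prime] [CharP F p] (m s k i : ℕ) :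
    (fun y => Sg F m (p ^ s) y - y)^[k] (Polynomial.C (Y F m i ^ p ^ s))
      = Polynomial.C (Y F m (i + k) ^ p ^ s) := by
  induction k generalizing i with
  | zero => simp
  | succ k ih =>
    rw [Function.iterate_succ_apply]
    have : Sg F m (p ^ s) (Polynomial.C (Y F m i ^ p ^ s)) - Polynomial.C (Y F m i ^ p ^ s)
        = Polynomial.C (Y F m (i + 1) ^ p ^ s) := by
      rw [Sg_C, map_pow, sg_Y, add_pow_char_pow]
      simp
    rw [this, ih]
    congr 3
    ring

lemma iterate_X {p : ℕ} [Fact p.Prime] [CharP F p] (m s k i : ℕ) :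
    (fun y => Sg F m (p ^ s) y - y)^[k + 1] (Polynomial.C (X i))
      = Polynomial.C (Y F m (i + k + 1)) := by
  rw [Function.iterate_succ_apply]
  have : Sg F m (p ^ s) (Polynomial.C (X i)) - Polynomial.C (X i)
        = Polynomial.C (Y F m (i + 1)) := by
    rw [Sg_C]; simp [sg]
  rw [this]
  clear this
  induction k generalizing i with
  | zero => simp
  | succ k ih =>
    rw [Function.iterate_succ_apply]
    have : Sg F m (p ^ s) (Polynomial.C (Y F m (i+1))) - Polynomial.C (Y F m (i+1))
        = Polynomial.C (Y F m (i + 1 + 1)) := by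
      rw [Sg_C, sg_Y]
      simp
    rw [this, ih]
    congr 2
    ring

/-- The `p^t`-th power of the action is a translation in `Z`. -/
lemma iterate_Sg {p : ℕ} [Fact p.Prime] [CharP F p] (t s : ℕ)
    (f : Polynomial (MvPolynomial ℕ F)) :
    (Sg F (p ^ t) (p ^ s))^[p ^ t] f =
      f.comp (Polynomial.X + Polynomial.C (X (p ^ t - 1) ^ p ^ s)) := by
  have hpos : 0 < p ^ t := pow_pos (Fact.out : p.Prime).pos t
  obtain ⟨m, hm⟩ : ∃ m, p ^ t = m + 1 := ⟨p ^ t - 1, by omega⟩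
  have key := hom_ext F ((Sg F (p ^ t) (p ^ s) ^ (p ^ t)).toRingHom)
    (Polynomial.compRingHom (Polynomial.X + Polynomial.C (X (p ^ t - 1) ^ p ^ s))) ?_ ?_ ?_
  · have := congrArg (fun g => g f) key
    simpa [AlgHom.coe_pow] using this
  · intro c
    have h : (Polynomial.C (C c) : Polynomial (MvPolynomial ℕ F)) = algebraMap F _ c := rfl
    rw [h]
    simp only [AlgHom.toRingHom_eq_coe, RingHom.coe_coe, AlgHom.commutes]
    rw [← h]
    simp
  · intro i
    simp only [AlgHom.toRingHom_eq_coe, RingHom.coe_coe, AlgHom.coe_pow]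
    rw [iterate_eq (p := p)]
    have h := iterate_X F (p := p) (p ^ t) s m i
    rw [← hm] at h
    rw [h]
    have : ¬ i + m + 1 < p ^ t := by omega
    simp [Y, this]
  · simp only [AlgHom.toRingHom_eq_coe, RingHom.coe_coe, AlgHom.coe_pow]
    rw [iterate_eq (p := p)]
    have e : (fun y => Sg F (p ^ t) (p ^ s) y - y)^[p ^ t] Polynomial.X
      = (fun y => Sg F (p ^ t) (p ^ s) y - y)^[m] (Polynomial.C (Y F (p ^ t) 0 ^ p ^ s)) := by
      have : (fun y => Sg F (p ^ t) (p ^ s) y - y)^[p ^ t] Polynomial.X =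
        (fun y => Sg F (p ^ t) (p ^ s) y - y)^[m+1] Polynomial.X := by
        congr 1
      rw [this, Function.iterate_succ_apply, Sg_X]
      simp [Y, hpos]
    rw [e, iterate_Y]
    have : m < p ^ t := by omega
    have h2 : p ^ t - 1 = m := by omega
    simp [Y, this, h2]

lemma tr_Sg {m m' : ℕ} (h : m' ≤ m) (h0 : 0 < m') (a : ℕ) (f : Polynomial (MvPolynomial ℕ F)) :
    (Sg F m a f).map (tr F m' : MvPolynomial ℕ F →+* MvPolynomial ℕ F) =
      Sg F m' a (f.map (tr F m' : MvPolynomial ℕ F →+* MvPolynomial ℕ F)) := by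
  have key := hom_ext F ((Polynomial.mapRingHom (tr F m' : MvPolynomial ℕ F →+* _)).comp
      (Sg F m a).toRingHom)
    ((Sg F m' a).toRingHom.comp (Polynomial.mapRingHom (tr F m' : MvPolynomial ℕ F →+* _))) ?_ ?_ ?_
  · exact congrArg (fun g => g f) key
  · intro c
    simp [Sg_C]
  · intro i
    have h1 : tr F m' (Y F m (i+1)) = Y F m' (i+1) := by
      by_cases hi : i + 1 < m
      · simp [Y, tr, hi]
      · have : ¬ i + 1 < m' := by omega
        simp [Y, hi, this]
    have h2 : tr F m' (X i) = Y F m' i := by simp [tr]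
    have h3 : sg F m (X i) = X i + Y F m (i + 1) := by simp [sg]
    simp [Sg_C, h1, h2, h3, sg_Y]
  · simp [Sg_X, tr, Y, h0]

lemma expand_Sg {p : ℕ} [Fact p.Prime] [CharP F p] (m s : ℕ)
    (f : Polynomial (MvPolynomial ℕ F)) :
    Sg F m (p ^ s) (Polynomial.expand _ p f) =
      Polynomial.expand _ p (Sg F m (p ^ (s + 1)) f) := by
  have key := hom_ext F ((Sg F m (p ^ s)).toRingHom.comp
      (Polynomial.expand (MvPolynomial ℕ F) p).toRingHom)
    ((Polynomial.expand (MvPolynomial ℕ F) p).toRingHom.comp (Sg F m (p ^ (s+1))).toRingHom) ?_ ?_ ?_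
  · exact congrArg (fun g => g f) key
  · intro c
    simp [Sg_C]
  · intro i
    simp [Sg_C]
  · simp only [AlgHom.toRingHom_eq_coe, RingHom.comp_apply, RingHom.coe_coe, Polynomial.expand_X,
      map_pow, Sg_X, map_add, Polynomial.expand_C]
    rw [add_pow_char, ← Polynomial.C_pow, ← Polynomial.C_pow, ← Polynomial.C_pow, ← pow_mul,
      pow_succ]

/-- evaluation of the small variables at zero -/
noncomputable def ev0 : MvPolynomial ℕ F →+* F := eval (fun _ => 0)

lemma ev0_tr (m : ℕ) : (ev0 F).comp (tr F m : MvPolynomial ℕ F →+* MvPolynomial ℕ F) = ev0 F := by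
  apply MvPolynomial.ringHom_ext
  · intro c; simp [ev0]
  · intro i
    by_cases h : i < m <;> simp [ev0, tr, Y, h]

lemma main_ind {p : ℕ} [Fact p.Prime] [CharP F p] (t : ℕ) :
    ∀ (s : ℕ) (f : Polynomial (MvPolynomial ℕ F)), Sg F (p ^ t) (p ^ s) f = f →
      ∃ h : Polynomial F, f.map (ev0 F) = Polynomial.expand F (p ^ (t + 1)) h := by
  have hp : 0 < p := (Fact.out : p.Prime).pos
  have hp1 : 1 < p := (Fact.out : p.Prime).one_lt
  induction t with
  | zero =>
    intro s f hf
    have h1 := iterate_Sg F (p := p) 0 s f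
    rw [Function.iterate_fixed hf] at h1
    obtain ⟨h, hh⟩ := periodic (p := p) (ev0 F) (X (p ^ 0 - 1) ^ p ^ s) (pow_ne_zero _ (X_ne_zero _))
      (by simp [ev0, hp.ne']) f.natDegree f le_rfl h1.symm
    exact ⟨h, by simpa using hh⟩
  | succ t ih =>
    intro s f hf
    have h1 := iterate_Sg F (p := p) (t + 1) s f
    rw [Function.iterate_fixed hf] at h1
    have hlt : p ^ t < p ^ (t + 1) := Nat.pow_lt_pow_right hp1 (by omega)
    have hnl : ¬ (p ^ (t + 1) - 1 < p ^ t) := by omega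
    obtain ⟨h, hh⟩ := periodic (p := p) (tr F (p ^ t) : MvPolynomial ℕ F →+* MvPolynomial ℕ F)
      (X (p ^ (t + 1) - 1) ^ p ^ s) (pow_ne_zero _ (X_ne_zero _))
      (by simp [tr, Y, hnl, hp.ne']) _ f le_rfl h1.symm
    have h2 := tr_Sg F hlt.le (pow_pos hp t) (p ^ s) f
    rw [hf, hh, expand_Sg] at h2
    obtain ⟨h', hh'⟩ := ih (s + 1) h (Polynomial.expand_injective hp h2).symm
    refine ⟨h', ?_⟩
    rw [← ev0_tr F (p ^ t), ← Polynomial.map_map, hh, Polynomial.map_expand, hh',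
      Polynomial.expand_expand, ← pow_succ']

/-- the map from the coordinate ring of `V` to `F[y][Z]`. -/
noncomputable def phi {k : ℕ} (n : Fin k → ℕ) (j : Fin k) (m : ℕ) :
    MvPolynomial (Σ j : Fin k, Fin (n j)) F →ₐ[F] Polynomial (MvPolynomial ℕ F) :=
  aeval fun q => if q.1 = j then
    (if (q.2 : ℕ) + 1 = n q.1 then Polynomial.X else Polynomial.C (Y F m (n q.1 - 2 - q.2))) else 0

lemma phi_sigma {k : ℕ} (n : Fin k → ℕ) (j : Fin k) (m : ℕ) (hm : 0 < m) (hmn : m < n j)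
    (f : MvPolynomial (Σ j : Fin k, Fin (n j)) F) :
    phi F n j m (sigmaAct n f) = Sg F m 1 (phi F n j m f) := by
  have key : (phi F n j m).comp (sigmaAct n) = (Sg F m 1).comp (phi F n j m) := by
    apply MvPolynomial.algHom_ext
    rintro ⟨j', i, hi⟩
    by_cases hj : j' = j
    · subst hj
      by_cases h0 : 0 < i
      · have e3 : ¬ (i - 1 + 1 = n j') := by omega
        by_cases h1 : i + 1 = n j'
        · have e : n j' - 2 - (i - 1) = 0 := by omega
          simp [phi, sigmaAct, h0, h1, e3, Sg_X, e, Y, hm]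
        · have e : n j' - 2 - (i - 1) = n j' - 2 - i + 1 := by omega
          simp [phi, sigmaAct, h0, h1, e3, Sg_C, e, sg_Y]
      · have h1 : ¬ (i + 1 = n j') := by omega
        have e : ¬ (n j' - 2 - i + 1 < m) := by omega
        have e2 : Y F m (n j' - 2 - i + 1) = 0 := by simp [Y, e]
        simp [phi, sigmaAct, h0, h1, Sg_C, sg_Y, e2]
    · by_cases h0 : 0 < i <;> simp [phi, sigmaAct, hj, h0]
  exact congrArg (fun g => g f) key

lemma lower {p : ℕ} [Fact p.Prime] [CharP F p] {k : ℕ} (n : Fin k → ℕ) (j : Fin k) (t : ℕ)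
    (hmn : p ^ t < n j) (f : MvPolynomial (Σ j : Fin k, Fin (n j)) F) (d : ℕ)
    (hf : sigmaAct n f = f) (hd : f.IsHomogeneous d)
    (v : (Σ j : Fin k, Fin (n j)) → F)
    (hv : ∀ q, v q = if q.1 = j ∧ (q.2 : ℕ) + 1 = n q.1 then 1 else 0)
    (hev : eval v f ≠ 0) : p ^ (t + 1) ∣ d := by
  have hp : 0 < p := (Fact.out : p.Prime).pos
  have h1 := phi_sigma F n j (p ^ t) (pow_pos hp t) hmn f
  rw [hf] at h1
  obtain ⟨h, hh⟩ := main_ind F (p := p) t 0 (phi F n j (p ^ t) f) (by simpa using h1.symm)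
  have key : (Polynomial.mapRingHom (ev0 F)).comp (phi F n j (p ^ t)).toRingHom =
      eval₂Hom (Polynomial.C) (fun q => Polynomial.X * Polynomial.C (v q)) := by
    apply MvPolynomial.ringHom_ext
    · intro c
      have : phi F n j (p ^ t) (C c) = Polynomial.C (C c) := by
        rw [← MvPolynomial.algebraMap_eq, AlgHom.commutes]; rfl
      simp [this, ev0]
    · rintro ⟨j', i, hi⟩
      have hY : ∀ i, ev0 F (Y F (p ^ t) i) = 0 := by
        intro i; by_cases h : i < p ^ t <;> simp [Y, ev0, h]
      by_cases hj : j' = j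
      · subst hj
        by_cases hi : i + 1 = n j' <;> simp [phi, hi, hY, hv]
      · simp [phi, hj, hv]
  have h2 : eval₂Hom (Polynomial.C) (fun q => Polynomial.X * Polynomial.C (v q)) f =
      Polynomial.X ^ d * Polynomial.C (eval v f) := by
    rw [coe_eval₂Hom, eval₂_eq, eval_eq, map_sum, Finset.mul_sum]
    refine Finset.sum_congr rfl fun m hm => ?_
    have hdeg : ∑ i ∈ m.support, m i = d := by
      have := hd (mem_support_iff.1 hm)
      simpa [Finsupp.weight_apply, Finsupp.sum] using this
    simp only [mul_pow, Finset.prod_mul_distrib, Finset.prod_pow_eq_pow_sum, hdeg, map_mul,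
      map_prod, map_pow]
    ring
  have h3 : Polynomial.X ^ d * Polynomial.C (eval v f) = Polynomial.expand F (p ^ (t + 1)) h := by
    rw [← h2, ← key, ← hh]; rfl
  have h4 := congrArg (fun g => Polynomial.coeff g d) h3
  simp only [Polynomial.coeff_X_pow_mul', Polynomial.coeff_expand (pow_pos hp (t+1))] at h4
  by_contra hnd
  simp [hnd] at h4
  exact hev h4

lemma sigma_pow {p : ℕ} [Fact p.Prime] [CharP F p] {k : ℕ} (n : Fin k → ℕ) (r : ℕ)
    (hnr : ∀ j, n j ≤ p ^ r) (q : Σ j : Fin k, Fin (n j)) :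
    (sigmaAct (F := F) n)^[p ^ r] (X q) = X q := by
  rw [iterate_eq (p := p)]
  have key : ∀ (N i : ℕ) (j : Fin k) (hi : i < n j), i < N →
      (fun y => sigmaAct (F := F) n y - y)^[N] (X ⟨j, ⟨i, hi⟩⟩) = 0 := by
    intro N
    induction N with
    | zero => intro i j hi h; omega
    | succ N ih =>
      intro i j hi h
      rw [Function.iterate_succ_apply]
      by_cases h0 : 0 < i
      · have e : sigmaAct (F := F) n (X ⟨j, ⟨i, hi⟩⟩) - X ⟨j, ⟨i, hi⟩⟩
          = X ⟨j, ⟨i - 1, by omega⟩⟩ := by simp [sigmaAct, h0]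
        rw [e]
        exact ih _ _ _ (by omega)
      · have e : sigmaAct (F := F) n (X ⟨j, ⟨i, hi⟩⟩) - X ⟨j, ⟨i, hi⟩⟩ = 0 := by
          simp [sigmaAct, h0]
        rw [e]
        apply Function.iterate_fixed
        simp
  obtain ⟨j, i, hi⟩ := q
  rw [key _ _ _ _ (lt_of_lt_of_le hi (hnr j)), add_zero]

lemma upper {p : ℕ} [Fact p.Prime] [CharP F p] {k : ℕ} (n : Fin k → ℕ) (r : ℕ)
    (hnr : ∀ j, n j ≤ p ^ r) (v : (Σ j : Fin k, Fin (n j)) → F) (hv : v ≠ 0)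
    (hfix : sigmaPt n v = v) :
    ∃ f : MvPolynomial (Σ j : Fin k, Fin (n j)) F,
      sigmaAct n f = f ∧ f.IsHomogeneous (p ^ r) ∧ eval v f ≠ 0 := by
  obtain ⟨q, hq⟩ := Function.ne_iff.1 hv
  refine ⟨∏ i ∈ Finset.range (p ^ r), (sigmaAct (F := F) n)^[i] (X q), ?_, ?_, ?_⟩
  · rw [map_prod]
    apply mul_right_cancel₀ (X_ne_zero (R := F) q)
    have h1 := Finset.prod_range_succ (fun i => (sigmaAct (F := F) n)^[i] (X q)) (p ^ r)
    rw [Finset.prod_range_succ', sigma_pow F n r hnr] at h1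
    simpa only [Function.iterate_succ_apply', Function.iterate_zero, id] using h1
  · have h := IsHomogeneous.prod (Finset.range (p ^ r))
      (fun i => (sigmaAct (F := F) n)^[i] (X q)) (fun _ => 1) ?_
    · simpa using h
    · intro i _
      induction i with
      | zero => simpa using isHomogeneous_X F q
      | succ i ih =>
        simp only [Function.iterate_succ_apply']
        have := IsHomogeneous.aeval (n := 1) (m := 1) (ih (by simp_all; omega))
          (fun q : (Σ j : Fin k, Fin (n j)) => (X q + if _ : 0 < (q.2 : ℕ) then
            X ⟨q.1, ⟨(q.2 : ℕ) - 1, lt_of_le_of_lt (Nat.sub_le _ _) q.2.isLt⟩⟩ else 0 :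
            MvPolynomial (Σ j : Fin k, Fin (n j)) F)) ?_
        · exact this
        · intro q
          apply IsHomogeneous.add (isHomogeneous_X _ _)
          split_ifs
          · exact isHomogeneous_X _ _
          · exact isHomogeneous_zero _ _ _
  · have hσ : ∀ f, eval v (sigmaAct n f) = eval v f := by
      intro f
      have : (eval v).comp (sigmaAct n).toRingHom = eval v := by
        apply MvPolynomial.ringHom_ext
        · intro c; simp
        · intro q
          have h := congrFun hfix q
          conv_rhs => rw [eval_X, ← h]
          by_cases h0 : 0 < (q.2 : ℕ) <;> simp [sigmaAct, sigmaPt, h0]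
      exact congrArg (fun g => g f) this
    have hit : ∀ i, eval v ((sigmaAct (F := F) n)^[i] (X q)) = v q := by
      intro i
      induction i with
      | zero => simp
      | succ i ih => rw [Function.iterate_succ_apply', hσ, ih]
    rw [map_prod]
    simp only [hit, Finset.prod_const]
    exact pow_ne_zero _ hq

end Stmt4

theorem stmt4 {F : Type*} [Field F] [IsAlgClosed F] {p : ℕ} (hp : p.Prime) [CharP F p]
    (r k : ℕ) (n : Fin k → ℕ) (hn : ∀ j, 0 < n j) (hnr : ∀ j, n j ≤ p ^ r)
    (hfaithful : ∃ j, p ^ (r - 1) < n j) :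
    deltaCyc (F := F) n = p ^ r := by
  have := Fact.mk hp
  obtain ⟨j, hj⟩ := hfaithful
  obtain ⟨t, rfl⟩ : ∃ t, r = t + 1 := by
    cases r with
    | zero => have := hnr j; simp at hj this; omega
    | succ t => exact ⟨t, rfl⟩
  simp only [Nat.add_sub_cancel] at hj
  have hup : ∀ v : (Σ j : Fin k, Fin (n j)) → F, v ≠ 0 → sigmaPt n v = v →
      epsCyc n v ≤ p ^ (t + 1) := by
    intro v hv hfix
    exact Nat.sInf_le ⟨pow_pos hp.pos _, Stmt4.upper F n (t + 1) hnr v hv hfix⟩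
  let v : (Σ j : Fin k, Fin (n j)) → F :=
    fun q => if q.1 = j ∧ (q.2 : ℕ) + 1 = n q.1 then 1 else 0
  have hv0 : v ≠ 0 := by
    intro h
    have h2 := congrFun h ⟨j, ⟨n j - 1, by have := hn j; omega⟩⟩
    have h3 : n j - 1 + 1 = n j := by have := hn j; omega
    simp [v, h3] at h2
  have hvfix : sigmaPt n v = v := by
    funext q
    obtain ⟨j', i, hi⟩ := q
    by_cases h0 : 0 < i
    · have : ¬ (i - 1 + 1 = n j') := by omega
      simp [sigmaPt, v, this]
    · simp [sigmaPt, h0]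
  have heps : epsCyc n v = p ^ (t + 1) := by
    apply le_antisymm (hup v hv0 hvfix)
    apply le_csInf
    · exact ⟨_, pow_pos hp.pos _, Stmt4.upper F n (t + 1) hnr v hv0 hvfix⟩
    · rintro d ⟨hd, f, hf, hhom, hev⟩
      exact Nat.le_of_dvd hd (Stmt4.lower F n j t hj f d hf hhom v (fun _ => rfl) hev)
  apply le_antisymm
  · apply csSup_le
    · exact ⟨_, v, hv0, hvfix, rfl⟩
    · rintro e ⟨w, hw, hwf, rfl⟩
      exact hup w hw hwf
  · apply le_csSup
    · refine ⟨p ^ (t + 1), ?_⟩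
      rintro e ⟨w, hw, hwf, rfl⟩
      exact hup w hw hwf
    · exact ⟨v, hv0, hvfix, heps.symm⟩
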